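/- Let p be a prime and k a positive integer. If f : {0,1}^n → {0,1} is a non-trivial symmetric Boolean function that is p-periodic and n ≥ (p−1)·k, then deg_{p^k}(f) = (p−1)·k. -/

import Mathlib

/-- Hamming weight of a Boolean input. -/
def wt {n : ℕ} (x : Fin n → Bool) : ℕ :=
  (Finset.univ.filter fun i => x i = true).card

/-- Coefficient of the monomial `∏_{i ∈ S} x_i` in the unique multilinear polynomial over
`ℤ_m` representing the Boolean function `f`, obtained by Möbius inversion. -/
def modCoeff (m n : ℕ) (f : (Fin n → Bool) → Bool) (S : Finset (Fin n)) : ZMod m :=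
  ∑ T ∈ S.powerset, (-1 : ZMod m) ^ (S.card - T.card) * (if f (fun i => decide (i ∈ T)) then 1 else 0)

/-- The modulo-`m` degree of a Boolean function: the total degree of the unique multilinear
polynomial over `ℤ_m` representing it. -/
def modDeg (m n : ℕ) (f : (Fin n → Bool) → Bool) : ℕ :=
  ((Finset.univ : Finset (Finset (Fin n))).filter fun S => modCoeff m n f S ≠ 0).sup Finset.card

/-- A Boolean function is symmetric if its value depends only on the Hamming weight. -/
def SymmetricBF {n : ℕ} (f : (Fin n → Bool) → Bool) : Prop :=
  ∀ x y, wt x = wt y → f x = f y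

/-- A Boolean function is non-trivial if it is not constant. -/
def NontrivialBF {n : ℕ} (f : (Fin n → Bool) → Bool) : Prop :=
  ∃ x y, f x ≠ f y

/-- A symmetric Boolean function is `ℓ`-periodic if its univariate version takes equal values
on arguments that agree modulo `ℓ`. -/
def PeriodicBF {n : ℕ} (ℓ : ℕ) (f : (Fin n → Bool) → Bool) : Prop :=
  ∀ x y : Fin n → Bool, wt x % ℓ = wt y % ℓ → f x = f y

/-- A Boolean function is non-degenerate if every coordinate is sensitive on some input. -/
def NondegenerateBF {n : ℕ} (f : (Fin n → Bool) → Bool) : Prop :=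
  ∀ i : Fin n, ∃ x, f x ≠ f (Function.update x i (!x i))

open Polynomial in
/-- The integer obtained from a polynomial by substituting `G j` for `X ^ j`. -/
noncomputable def umbralEval (G : ℕ → ℤ) : ℤ[X] →ₗ[ℤ] ℤ where
  toFun P := aeval (LinearMap.funLeft ℤ ℤ Nat.succ) P G 0
  map_add' P Q := by simp
  map_smul' a P := by simp

section Umbral

open Polynomial

theorem funLeft_succ_pow_apply (G : ℕ → ℤ) (j i : ℕ) :
    (LinearMap.funLeft ℤ ℤ Nat.succ ^ j) G i = G (i + j) := by
  induction j generalizing i with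
  | zero => simp
  | succ j ih =>
    rw [pow_succ', Module.End.mul_apply, LinearMap.funLeft_apply, ih]
    congr 1
    omega

theorem umbralEval_X_pow (G : ℕ → ℤ) (j : ℕ) : umbralEval G (X ^ j) = G j := by
  simp [umbralEval, funLeft_succ_pow_apply]

theorem umbralEval_C_mul (G : ℕ → ℤ) (a : ℤ) (P : ℤ[X]) :
    umbralEval G (C a * P) = a * umbralEval G P := by
  rw [← smul_eq_C_mul, map_smul, smul_eq_mul]

/-- On a `p`-periodic sequence, `umbralEval` factors through `ℤ[X] / (X ^ p - 1)`. -/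
theorem umbralEval_eq_of_dvd {G : ℕ → ℤ} {p : ℕ} (hG : ∀ j, G (j + p) = G j) {P Q : ℤ[X]}
    (h : X ^ p - 1 ∣ P - Q) : umbralEval G P = umbralEval G Q := by
  obtain ⟨R, hR⟩ := h
  rw [← sub_eq_zero, ← map_sub, hR, mul_comm]
  have h0 : (LinearMap.funLeft ℤ ℤ Nat.succ ^ p - 1) G = 0 := by
    ext i
    simp [funLeft_succ_pow_apply, hG]
  change (aeval (LinearMap.funLeft ℤ ℤ Nat.succ) (R * (X ^ p - 1))) G 0 = 0
  rw [map_mul, Module.End.mul_apply, map_sub, map_pow, aeval_X, map_one, h0, map_zero,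
    Pi.zero_apply]

theorem umbralEval_X_sub_one_pow (G : ℕ → ℤ) (d : ℕ) :
    umbralEval G ((X - 1) ^ d) =
      ∑ j ∈ Finset.range (d + 1), (d.choose j : ℤ) * ((-1) ^ (d - j) * G j) := by
  rw [sub_eq_add_neg, add_pow, map_sum]
  refine Finset.sum_congr rfl fun j _ => ?_
  have h : (X : ℤ[X]) ^ j * (-1) ^ (d - j) * (d.choose j : ℤ[X]) =
      C ((d.choose j : ℤ) * (-1) ^ (d - j)) * X ^ j := by
    simp only [map_mul, map_pow, map_neg, map_one, map_natCast]
    ring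
  rw [h, umbralEval_C_mul, umbralEval_X_pow, mul_assoc]

/-- Modulo a prime `p`, `(X - 1) ^ (p - 1)` is `1 + X + ⋯ + X ^ (p - 1)`. -/
theorem exists_X_sub_one_pow_pred_prime {p : ℕ} (hp : p.Prime) :
    ∃ v : ℤ[X], (X - 1) ^ (p - 1) = ∑ j ∈ Finset.range p, X ^ j + C (p : ℤ) * v ∧
      v.eval 1 = -1 := by
  have : Fact p.Prime := ⟨hp⟩
  have hp1 : p - 1 + 1 = p := Nat.sub_add_cancel hp.one_le
  have hmod : C (p : ℤ) ∣ (X - 1) ^ (p - 1) - ∑ j ∈ Finset.range p, (X : ℤ[X]) ^ j := by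
    rw [C_dvd_iff_dvd_coeff]
    intro i
    rw [← ZMod.intCast_zmod_eq_zero_iff_dvd, ← eq_intCast (Int.castRingHom (ZMod p)),
      ← coeff_map]
    suffices h : map (Int.castRingHom (ZMod p))
        ((X - 1) ^ (p - 1) - ∑ j ∈ Finset.range p, (X : ℤ[X]) ^ j) = 0 by
      rw [h, coeff_zero]
    have hX : (X - 1 : (ZMod p)[X]) ≠ 0 := X_sub_C_ne_zero 1
    apply mul_right_cancel₀ hX
    simp only [Polynomial.map_sub, Polynomial.map_pow, map_X, Polynomial.map_one,
      Polynomial.map_sum, sub_mul, zero_mul]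
    rw [geom_sum_mul, ← pow_succ, hp1, sub_pow_char, one_pow, sub_self]
  obtain ⟨v, hv⟩ := hmod
  refine ⟨v, by rw [← hv]; ring, ?_⟩
  have h1 := congrArg (eval 1) hv
  have h2 : p - 1 ≠ 0 := by have := hp.two_le; omega
  simp [eval_finsetSum, h2] at h1
  have hp0 : (p : ℤ) ≠ 0 := by exact_mod_cast hp.ne_zero
  apply mul_left_cancel₀ hp0
  linarith

theorem prime_pow_dvd_umbralEval {p : ℕ} (hp : p.Prime) {G : ℕ → ℤ}
    (hG : ∀ j, G (j + p) = G j) {k d : ℕ} (hd : (p - 1) * k < d) :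
    (p : ℤ) ^ k ∣ umbralEval G ((X - 1) ^ d) := by
  obtain ⟨v, hv, -⟩ := exists_X_sub_one_pow_pred_prime hp
  obtain ⟨e, rfl⟩ := Nat.exists_eq_add_of_lt hd
  have h : (X : ℤ[X]) ^ p - 1 ∣ (X - 1) ^ ((p - 1) * k + e + 1) -
      C ((p : ℤ) ^ k) * (v ^ k * (X - 1) ^ (e + 1)) := by
    have h1 := sub_dvd_pow_sub_pow ((X - 1 : ℤ[X]) ^ (p - 1)) (C (p : ℤ) * v) k
    rw [hv, add_sub_cancel_right, ← hv] at h1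
    rw [← geom_sum_mul]
    convert (mul_dvd_mul_right h1 (X - 1)).mul_right ((X - 1) ^ e) using 1
    rw [C_pow, mul_pow]
    ring
  rw [umbralEval_eq_of_dvd hG h, umbralEval_C_mul]
  exact dvd_mul_right _ _

theorem not_prime_pow_dvd_umbralEval {p : ℕ} (hp : p.Prime) {G : ℕ → ℤ}
    (hG : ∀ j, G (j + p) = G j) (hs : ¬ (p : ℤ) ∣ ∑ j ∈ Finset.range p, G j) {k : ℕ}
    (hk : 0 < k) : ¬ (p : ℤ) ^ k ∣ umbralEval G ((X - 1) ^ ((p - 1) * k)) := by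
  obtain ⟨v, hv, hv1⟩ := exists_X_sub_one_pow_pred_prime hp
  obtain ⟨k, rfl⟩ : ∃ l, k = l + 1 := ⟨k - 1, by omega⟩
  have hq : p - 1 ≠ 0 := by have := hp.two_le; omega
  have h : (X : ℤ[X]) ^ p - 1 ∣ (X - 1) ^ ((p - 1) * (k + 1)) -
      C ((p : ℤ) ^ k) * (C ((-1) ^ k) * ∑ j ∈ Finset.range p, X ^ j + C (p : ℤ) * v ^ (k + 1)) := by
    have h1 := sub_dvd_pow_sub_pow ((X - 1 : ℤ[X]) ^ (p - 1)) (C (p : ℤ) * v) k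
    rw [hv, add_sub_cancel_right, ← hv] at h1
    have h2 := mul_dvd_mul h1 (dvd_pow_self (X - 1 : ℤ[X]) hq)
    have h3 := X_sub_C_dvd_sub_C_eval (a := (1 : ℤ)) (p := v ^ k)
    rw [eval_pow, hv1, C_1] at h3
    have h4 := (mul_dvd_mul_left (∑ j ∈ Finset.range p, (X : ℤ[X]) ^ j) h3).mul_left
      (C ((p : ℤ) ^ k))
    rw [← geom_sum_mul]
    convert dvd_add h2 h4 using 1
    rw [sub_mul, ← pow_mul, ← pow_add, ← mul_add_one, hv, C_pow, mul_pow]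
    ring
  rw [umbralEval_eq_of_dvd hG h, umbralEval_C_mul, map_add, umbralEval_C_mul, umbralEval_C_mul,
    map_sum, pow_succ]
  simp only [umbralEval_X_pow]
  have hp0 : (p : ℤ) ^ k ≠ 0 := pow_ne_zero _ (by exact_mod_cast hp.ne_zero)
  rw [mul_dvd_mul_iff_left hp0, dvd_add_left (dvd_mul_right _ _)]
  rcases neg_one_pow_eq_or ℤ k with h | h <;> simpa [h] using hs

end Umbral

theorem wt_decide_mem {n : ℕ} (T : Finset (Fin n)) : wt (fun i => decide (i ∈ T)) = T.card := by
  simp [wt]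

theorem exists_wt_eq {n j : ℕ} (hj : j ≤ n) : ∃ x : Fin n → Bool, wt x = j := by
  obtain ⟨T, -, hT⟩ := Finset.exists_subset_card_eq
    (s := (Finset.univ : Finset (Fin n))) (n := j) (by simpa using hj)
  exact ⟨_, (wt_decide_mem T).trans hT⟩

/-- The univariate version of a periodic Boolean function extends to a periodic sequence. -/
theorem PeriodicBF.exists_univariate {n p : ℕ} (hp : 0 < p) (hn : p - 1 ≤ n)
    {f : (Fin n → Bool) → Bool} (hper : PeriodicBF p f) :
    ∃ F : ℕ → Bool, (∀ j, F (j + p) = F j) ∧ ∀ x, f x = F (wt x) := by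
  have hx : ∀ j, ∃ x : Fin n → Bool, wt x = j % p := fun j =>
    exists_wt_eq (by have := Nat.mod_lt j hp; omega)
  choose x hx using hx
  exact ⟨fun j => f (x j), fun j => hper _ _ (by simp [hx]), fun y => hper _ _ (by simp [hx])⟩

open Polynomial in
theorem modCoeff_eq_umbralEval {m n : ℕ} {f : (Fin n → Bool) → Bool} {F : ℕ → Bool}
    (hF : ∀ x, f x = F (wt x)) (S : Finset (Fin n)) :
    modCoeff m n f S =
      (umbralEval (fun j => if F j then 1 else 0) ((X - 1) ^ S.card) : ZMod m) := by
  simp only [modCoeff, hF, wt_decide_mem]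
  rw [Finset.sum_powerset_apply_card
    (fun j => (-1 : ZMod m) ^ (S.card - j) * (if F j then 1 else 0)), umbralEval_X_sub_one_pow]
  push_cast
  simp only [nsmul_eq_mul]

/-- A non-trivial symmetric `p`-periodic Boolean function on `n ≥ (p−1)k`
variables has `deg_{p^k}(f) = (p−1)k` exactly. -/
theorem stmt5 (p k n : ℕ) (hp : p.Prime) (hk : 0 < k)
    (f : (Fin n → Bool) → Bool) (hsym : SymmetricBF f) (hnt : NontrivialBF f)
    (hper : PeriodicBF p f) (hn : (p - 1) * k ≤ n) :
    modDeg (p ^ k) n f = (p - 1) * k := by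
  obtain ⟨F, hFp, hF⟩ := hper.exists_univariate hp.pos ((Nat.le_mul_of_pos_right _ hk).trans hn)
  have hG : ∀ j, (fun j => if F j then (1 : ℤ) else 0) (j + p) =
      (fun j => if F j then (1 : ℤ) else 0) j := by simp [hFp]
  have hmod : ∀ j, F (j % p) = F j := fun j => Function.Periodic.map_mod_nat hFp j
  have hval : ∀ b, ∃ j < p, F j = b := by
    obtain ⟨x, y, hxy⟩ := hnt
    rw [hF, hF, ← hmod (wt x), ← hmod (wt y)] at hxy
    intro b
    by_cases hb : F (wt x % p) = b
    · exact ⟨_, Nat.mod_lt _ hp.pos, hb⟩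
    · exact ⟨_, Nat.mod_lt (wt y) hp.pos, by grind⟩
  have hs : ¬ (p : ℤ) ∣ ∑ j ∈ Finset.range p, if F j then (1 : ℤ) else 0 := by
    rw [Finset.sum_boole]
    norm_cast
    obtain ⟨a, ha, hFa⟩ := hval true
    obtain ⟨b, hb, hFb⟩ := hval false
    refine Nat.not_dvd_of_pos_of_lt (Finset.card_pos.2 ⟨a, by simp [ha, hFa]⟩) ?_
    refine (Finset.card_lt_card (Finset.filter_ssubset.2 ⟨b, ?_⟩)).trans_eq (Finset.card_range p)
    simp [hb, hFb]
  apply le_antisymm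
  · refine Finset.sup_le fun S hS => ?_
    by_contra! hlt
    refine (Finset.mem_filter.1 hS).2 ?_
    rw [modCoeff_eq_umbralEval hF, ZMod.intCast_zmod_eq_zero_iff_dvd, Nat.cast_pow]
    exact prime_pow_dvd_umbralEval hp hG hlt
  · obtain ⟨S, -, hS⟩ := Finset.exists_subset_card_eq
      (s := (Finset.univ : Finset (Fin n))) (n := (p - 1) * k) (by simpa using hn)
    rw [← hS]
    refine Finset.le_sup (f := Finset.card) (Finset.mem_filter.2 ⟨Finset.mem_univ _, ?_⟩)
    rw [modCoeff_eq_umbralEval hF, Ne, ZMod.intCast_zmod_eq_zero_iff_dvd, hS, Nat.cast_pow]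
    exact not_prime_pow_dvd_umbralEval hp hG hs hk
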